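/- Under the Volterra system setup, for every t ∈ [0,T], |z(t) − z̃(t)| ≤ L · ( J^{α₂−ε}_0 |w − z̃|(t) + J^{α₂−1+ε}_0 |z − z̃|(t) + (T^{α₂−1}/Γ(α₂)) · ‖J^ε_0 z̃ − z̃‖_∞ ). -/

import Mathlib

/-- Riemann–Liouville fractional integral of order `α` with base point `a`. -/
noncomputable def rlInt (a α : ℝ) (y : ℝ → ℝ) (t : ℝ) : ℝ :=
  (1 / Real.Gamma α) * ∫ τ in a..t, (t - τ) ^ (α - 1) * y τ

open MeasureTheory Set

theorem integral_sub_rpow_mul_sub_rpow {a b σ t : ℝ} (ha : 0 < a) (hb : 0 < b) (hσ : σ < t) :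
    ∫ τ in σ..t, (t - τ) ^ (a - 1) * (τ - σ) ^ (b - 1) =
      (t - σ) ^ (a + b - 1) * ProbabilityTheory.beta a b := by
  have hts : 0 < t - σ := sub_pos.2 hσ
  have hscaled := Complex.betaIntegral_scaled (b : ℂ) (a : ℂ) hts
  have hshift := intervalIntegral.integral_comp_sub_right (a := σ) (b := t)
    (fun x : ℝ => (t - σ - x) ^ (a - 1) * x ^ (b - 1)) σ
  simp only [sub_self, sub_sub_sub_cancel_right] at hshift
  rw [hshift]
  have hcast : ((∫ x in 0..(t - σ), (t - σ - x) ^ (a - 1) * x ^ (b - 1) : ℝ) : ℂ) =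
      ((t - σ : ℝ) : ℂ) ^ ((b : ℂ) + a - 1) * Complex.betaIntegral b a := by
    rw [← hscaled, ← intervalIntegral.integral_ofReal]
    refine intervalIntegral.integral_congr fun x hx => ?_
    rw [uIcc_of_le hts.le] at hx
    rw [Complex.ofReal_mul, Complex.ofReal_cpow (sub_nonneg.2 hx.2), Complex.ofReal_cpow hx.1]
    push_cast
    ring
  rw [← Complex.ofReal_re (∫ x in 0..(t - σ), (t - σ - x) ^ (a - 1) * x ^ (b - 1)), hcast,
    show (b : ℂ) + a - 1 = ((a + b - 1 : ℝ) : ℂ) by push_cast; ring,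
    ← Complex.ofReal_cpow hts.le, Complex.re_ofReal_mul,
    ← ProbabilityTheory.beta_eq_betaIntegralReal b a hb ha]
  simp only [ProbabilityTheory.beta, mul_comm (Real.Gamma b), add_comm b]

theorem intervalIntegrable_sub_rpow_mul_sub_rpow {a b σ t : ℝ} (ha : 0 < a) (hb : 0 < b)
    (hσ : σ < t) :
    IntervalIntegrable (fun τ => (t - τ) ^ (a - 1) * (τ - σ) ^ (b - 1)) volume σ t := by
  by_contra h
  have := integral_sub_rpow_mul_sub_rpow ha hb hσ
  rw [intervalIntegral.integral_undef h] at this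
  exact (mul_pos (Real.rpow_pos_of_pos (sub_pos.2 hσ) _)
    (ProbabilityTheory.beta_pos ha hb)).ne this

theorem intervalIntegrable_sub_rpow {α : ℝ} (hα : 0 < α) (t : ℝ) :
    IntervalIntegrable (fun τ => (t - τ) ^ (α - 1)) volume 0 t := by
  have h := (intervalIntegral.intervalIntegrable_rpow' (r := α - 1) (a := 0) (b := t)
    (by linarith)).comp_sub_left t
  simpa using h.symm

theorem intervalIntegrable_sub_rpow_mul {α t : ℝ} {g : ℝ → ℝ} (hα : 0 < α) (ht : 0 ≤ t)
    (hg : ContinuousOn g (Icc 0 t)) :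
    IntervalIntegrable (fun τ => (t - τ) ^ (α - 1) * g τ) volume 0 t :=
  (intervalIntegrable_sub_rpow hα t).mul_continuousOn (by rwa [uIcc_of_le ht])

theorem rlInt_const {α : ℝ} (hα : 0 < α) (c t : ℝ) :
    rlInt 0 α (fun _ => c) t = t ^ α / Real.Gamma (α + 1) * c := by
  have h := intervalIntegral.integral_comp_sub_left (a := 0) (b := t)
    (fun x : ℝ => x ^ (α - 1)) t
  simp only [sub_self, sub_zero] at h
  rw [rlInt, intervalIntegral.integral_mul_const, h, integral_rpow (Or.inl (by linarith)),
    Real.Gamma_add_one hα.ne', sub_add_cancel, Real.zero_rpow hα.ne']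
  have := (Real.Gamma_pos_of_pos hα).ne'
  field_simp
  ring

theorem abs_rlInt_le {α t : ℝ} {g h : ℝ → ℝ} (hα : 0 < α) (ht : 0 ≤ t)
    (hh : IntervalIntegrable (fun τ => (t - τ) ^ (α - 1) * h τ) volume 0 t)
    (hgh : ∀ τ ∈ Icc 0 t, |g τ| ≤ h τ) :
    |rlInt 0 α g t| ≤ rlInt 0 α h t := by
  have hΓ : 0 < 1 / Real.Gamma α := one_div_pos.2 (Real.Gamma_pos_of_pos hα)
  rw [rlInt, rlInt, abs_mul, abs_of_pos hΓ]
  refine mul_le_mul_of_nonneg_left ?_ hΓ.le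
  rw [← Real.norm_eq_abs]
  refine intervalIntegral.norm_integral_le_of_norm_le ht (Filter.Eventually.of_forall ?_) hh
  intro τ hτ
  have hk : 0 ≤ (t - τ) ^ (α - 1) := Real.rpow_nonneg (sub_nonneg.2 hτ.2) _
  rw [Real.norm_eq_abs, abs_mul, abs_of_nonneg hk]
  exact mul_le_mul_of_nonneg_left (hgh τ (Ioc_subset_Icc_self hτ)) hk

theorem rlInt_sub {α t : ℝ} {g h : ℝ → ℝ} (hα : 0 < α) (ht : 0 ≤ t)
    (hg : ContinuousOn g (Icc 0 t)) (hh : ContinuousOn h (Icc 0 t)) :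
    rlInt 0 α g t - rlInt 0 α h t = rlInt 0 α (fun τ => g τ - h τ) t := by
  simp only [rlInt, mul_sub]
  rw [intervalIntegral.integral_sub (intervalIntegrable_sub_rpow_mul hα ht hg)
    (intervalIntegrable_sub_rpow_mul hα ht hh), mul_sub]

theorem abs_rlInt_sub_rlInt_le {α t : ℝ} {g h : ℝ → ℝ} (hα : 0 < α) (ht : 0 ≤ t)
    (hg : ContinuousOn g (Icc 0 t)) (hh : ContinuousOn h (Icc 0 t)) :
    |rlInt 0 α g t - rlInt 0 α h t| ≤ rlInt 0 α (fun τ => |g τ - h τ|) t := by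
  rw [rlInt_sub hα ht hg hh]
  exact abs_rlInt_le hα ht (intervalIntegrable_sub_rpow_mul hα ht (hg.sub hh).abs)
    fun _ _ => le_rfl

/-- The integrand of the iterated fractional integral `J^a (J^b g)` at `t`, extended by zero to
all pairs `(τ, σ)` with `τ ≤ σ`. -/
noncomputable def rlKernel (a b t : ℝ) (g : ℝ → ℝ) (τ σ : ℝ) : ℝ :=
  if σ < τ then (t - τ) ^ (a - 1) * (τ - σ) ^ (b - 1) * g σ else 0

theorem rlKernel_eq_indicator (a b t : ℝ) (g : ℝ → ℝ) (τ σ : ℝ) :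
    rlKernel a b t g τ σ =
      (Ioi σ).indicator (fun τ => (t - τ) ^ (a - 1) * (τ - σ) ^ (b - 1) * g σ) τ := by
  simp [rlKernel, indicator]

theorem integrable_rlKernel_left {a b t σ : ℝ} (g : ℝ → ℝ) (ha : 0 < a) (hb : 0 < b)
    (hσ : σ ∈ Ioo 0 t) :
    Integrable (fun τ => rlKernel a b t g τ σ) (volume.restrict (Ioc 0 t)) := by
  simp only [rlKernel_eq_indicator]
  rw [integrable_indicator_iff measurableSet_Ioi, IntegrableOn,
    Measure.restrict_restrict measurableSet_Ioi, inter_comm, Ioc_inter_Ioi, sup_of_le_right hσ.1.le]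
  exact ((intervalIntegrable_sub_rpow_mul_sub_rpow ha hb hσ.2).mul_const (g σ)).1

theorem integral_rlKernel_left {a b t σ : ℝ} (g : ℝ → ℝ) (ha : 0 < a) (hb : 0 < b)
    (hσ : σ ∈ Ioo 0 t) :
    ∫ τ in Ioc 0 t, rlKernel a b t g τ σ =
      ProbabilityTheory.beta a b * ((t - σ) ^ (a + b - 1) * g σ) := by
  simp only [rlKernel_eq_indicator]
  rw [integral_indicator measurableSet_Ioi,
    Measure.restrict_restrict measurableSet_Ioi, inter_comm, Ioc_inter_Ioi, sup_of_le_right hσ.1.le,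
    ← intervalIntegral.integral_of_le hσ.2.le, intervalIntegral.integral_mul_const,
    integral_sub_rpow_mul_sub_rpow ha hb hσ.2]
  ring

theorem integral_rlKernel_right {a b t τ : ℝ} (g : ℝ → ℝ) (hb : 0 < b) (hτ : τ ∈ Ioc 0 t) :
    ∫ σ in Ioc 0 t, rlKernel a b t g τ σ =
      Real.Gamma b * ((t - τ) ^ (a - 1) * rlInt 0 b g τ) := by
  have h : (fun σ => rlKernel a b t g τ σ) =
      (Iio τ).indicator (fun σ => (t - τ) ^ (a - 1) * (τ - σ) ^ (b - 1) * g σ) := by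
    ext σ
    simp [rlKernel, indicator]
  have hset : Iio τ ∩ Ioc 0 t = Ioo 0 τ := by
    ext σ
    simp only [mem_inter_iff, mem_Iio, mem_Ioc, mem_Ioo]
    exact ⟨fun hx => ⟨hx.2.1, hx.1⟩, fun hx => ⟨hx.2, hx.1, hx.2.le.trans hτ.2⟩⟩
  rw [h, integral_indicator measurableSet_Iio, Measure.restrict_restrict measurableSet_Iio, hset,
    ← integral_Ioc_eq_integral_Ioo, ← intervalIntegral.integral_of_le hτ.1.le, rlInt]
  simp only [mul_assoc]
  rw [intervalIntegral.integral_const_mul]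
  have := (Real.Gamma_pos_of_pos hb).ne'
  field_simp

theorem ae_restrict_Ioc_mem_Ioo (a b : ℝ) : ∀ᵐ x ∂volume.restrict (Ioc a b), x ∈ Ioo a b := by
  rw [← restrict_Ioo_eq_restrict_Ioc]
  exact ae_restrict_mem measurableSet_Ioo

theorem integrable_rlKernel {a b t : ℝ} {g : ℝ → ℝ} (ha : 0 < a) (hb : 0 < b) (ht : 0 ≤ t)
    (hg : ContinuousOn g (Icc 0 t)) :
    Integrable (Function.uncurry (rlKernel a b t g))
      ((volume.restrict (Ioc 0 t)).prod (volume.restrict (Ioc 0 t))) := by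
  have hmeas : AEStronglyMeasurable (Function.uncurry (rlKernel a b t g))
      ((volume.restrict (Ioc 0 t)).prod (volume.restrict (Ioc 0 t))) := by
    have hgm : AEStronglyMeasurable g (volume.restrict (Ioc 0 t)) :=
      (hg.mono Ioc_subset_Icc_self).aestronglyMeasurable measurableSet_Ioc
    have hset : MeasurableSet {p : ℝ × ℝ | p.2 < p.1} :=
      measurableSet_lt measurable_snd measurable_fst
    have hk : Measurable fun p : ℝ × ℝ => (t - p.1) ^ (a - 1) * (p.1 - p.2) ^ (b - 1) := by
      fun_prop
    have heq : Function.uncurry (rlKernel a b t g) = {p : ℝ × ℝ | p.2 < p.1}.indicator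
        (fun p => (t - p.1) ^ (a - 1) * (p.1 - p.2) ^ (b - 1) * g p.2) := by
      ext p
      simp [rlKernel, indicator, Function.uncurry]
    rw [heq]
    exact (hk.aestronglyMeasurable.mul hgm.comp_snd).indicator hset
  rw [integrable_prod_iff' hmeas]
  constructor
  · filter_upwards [ae_restrict_Ioc_mem_Ioo 0 t] with σ hσ
    exact integrable_rlKernel_left g ha hb hσ
  · have hint := ((intervalIntegrable_sub_rpow_mul (add_pos ha hb) ht hg.abs).const_mul
      (ProbabilityTheory.beta a b)).1
    refine hint.congr ?_
    filter_upwards [ae_restrict_Ioc_mem_Ioo 0 t] with σ hσ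
    rw [← integral_rlKernel_left (fun x => |g x|) ha hb hσ]
    refine setIntegral_congr_fun measurableSet_Ioc fun τ hτ => ?_
    simp only [Function.uncurry, rlKernel]
    split_ifs with h
    · rw [Real.norm_eq_abs, abs_mul, abs_of_nonneg (mul_nonneg
        (Real.rpow_nonneg (sub_nonneg.2 hτ.2) _) (Real.rpow_nonneg (sub_nonneg.2 h.le) _))]
    · simp

theorem intervalIntegrable_sub_rpow_mul_rlInt {a b t : ℝ} {g : ℝ → ℝ} (ha : 0 < a) (hb : 0 < b)
    (ht : 0 ≤ t) (hg : ContinuousOn g (Icc 0 t)) :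
    IntervalIntegrable (fun τ => (t - τ) ^ (a - 1) * rlInt 0 b g τ) volume 0 t := by
  rw [intervalIntegrable_iff_integrableOn_Ioc_of_le ht]
  refine ((integrable_rlKernel ha hb ht hg).integral_prod_left.const_mul
    (Real.Gamma b)⁻¹).congr ?_
  filter_upwards [ae_restrict_mem measurableSet_Ioc] with τ hτ
  simp only [Function.uncurry]
  rw [integral_rlKernel_right g hb hτ, inv_mul_cancel_left₀ (Real.Gamma_pos_of_pos hb).ne']

/-- The semigroup law of Riemann–Liouville fractional integration. -/
theorem rlInt_rlInt {a b t : ℝ} {g : ℝ → ℝ} (ha : 0 < a) (hb : 0 < b)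
    (ht : 0 ≤ t) (hg : ContinuousOn g (Icc 0 t)) :
    rlInt 0 a (rlInt 0 b g) t = rlInt 0 (a + b) g t := by
  have hswap := integral_integral_swap (integrable_rlKernel ha hb ht hg)
  have hleft : ∫ σ in Ioc 0 t, ∫ τ in Ioc 0 t, rlKernel a b t g τ σ =
      ProbabilityTheory.beta a b * ∫ σ in 0..t, (t - σ) ^ (a + b - 1) * g σ := by
    rw [intervalIntegral.integral_of_le ht, ← integral_const_mul]
    refine integral_congr_ae ?_
    filter_upwards [ae_restrict_Ioc_mem_Ioo 0 t] with σ hσ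
    exact integral_rlKernel_left g ha hb hσ
  have hright : ∫ τ in Ioc 0 t, ∫ σ in Ioc 0 t, rlKernel a b t g τ σ =
      Real.Gamma b * ∫ τ in 0..t, (t - τ) ^ (a - 1) * rlInt 0 b g τ := by
    rw [intervalIntegral.integral_of_le ht, ← integral_const_mul]
    exact setIntegral_congr_fun measurableSet_Ioc fun τ hτ => integral_rlKernel_right g hb hτ
  rw [hleft, hright, ProbabilityTheory.beta] at hswap
  have hΓa := (Real.Gamma_pos_of_pos ha).ne'
  have hΓb := (Real.Gamma_pos_of_pos hb).ne'
  have hΓab := (Real.Gamma_pos_of_pos (add_pos ha hb)).ne'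
  rw [rlInt, rlInt]
  field_simp at hswap ⊢
  linarith

theorem bddAbove_abs_rlInt_sub {α T : ℝ} {g : ℝ → ℝ} (hα : 0 < α)
    (hg : ContinuousOn g (Icc 0 T)) :
    BddAbove (range fun τ : Icc (0 : ℝ) T => |rlInt 0 α g τ - g τ|) := by
  obtain ⟨M, hM⟩ := isCompact_Icc.exists_bound_of_continuousOn hg
  refine ⟨T ^ α / Real.Gamma (α + 1) * M + M, ?_⟩
  rintro _ ⟨⟨τ, hτ⟩, rfl⟩
  have hM0 : 0 ≤ M := (norm_nonneg _).trans (hM τ hτ)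
  have hJ : |rlInt 0 α g τ| ≤ τ ^ α / Real.Gamma (α + 1) * M := by
    rw [← rlInt_const hα M τ]
    exact abs_rlInt_le hα hτ.1 (intervalIntegrable_sub_rpow_mul hα hτ.1 continuousOn_const)
      fun x hx => hM x ⟨hx.1, hx.2.trans hτ.2⟩
  have hΓ : 0 < Real.Gamma (α + 1) := Real.Gamma_pos_of_pos (by linarith)
  have hpow : τ ^ α / Real.Gamma (α + 1) * M ≤ T ^ α / Real.Gamma (α + 1) * M := by
    gcongr
    exacts [hτ.1, hτ.2]
  exact (abs_sub _ _).trans (add_le_add (hJ.trans hpow) (hM τ hτ))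

theorem stmt8 (T α₂ ε s y₀ L : ℝ) (f : ℝ → ℝ → ℝ → ℝ)
    (yh w z yt zt : ℝ → ℝ)
    (hT : 0 < T) (hα₂ : 1 < α₂) (hα₂' : α₂ < 2) (hε : 0 < ε) (hε1 : ε < 1) (hL : 0 < L)
    (hfc : Continuous fun p : ℝ × ℝ × ℝ => f p.1 p.2.1 p.2.2)
    (hlip : ∀ t ∈ Set.Icc (0:ℝ) T, ∀ x₁ x₂ y₁ y₂ : ℝ,
      |f t x₁ y₁ - f t x₂ y₂| ≤ L * (|x₁ - x₂| + |y₁ - y₂|))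
    (hyh : ContinuousOn yh (Set.Icc 0 T)) (hw : ContinuousOn w (Set.Icc 0 T))
    (hz : ContinuousOn z (Set.Icc 0 T)) (hyt : ContinuousOn yt (Set.Icc 0 T))
    (hzt : ContinuousOn zt (Set.Icc 0 T))
    (heq1 : ∀ t ∈ Set.Icc (0:ℝ) T, yh t = y₀ + rlInt 0 (1 - ε) w t)
    (heq2 : ∀ t ∈ Set.Icc (0:ℝ) T, w t = rlInt 0 ε z t)
    (heq3 : ∀ t ∈ Set.Icc (0:ℝ) T,
      z t = s + rlInt 0 (α₂ - 1) (fun τ => f τ (yh τ) (w τ)) t)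
    (heq4 : ∀ t ∈ Set.Icc (0:ℝ) T, yt t = y₀ + rlInt 0 (1 - ε) zt t)
    (heq5 : ∀ t ∈ Set.Icc (0:ℝ) T,
      zt t = s + rlInt 0 (α₂ - 1) (fun τ => f τ (yt τ) (zt τ)) t) :
    ∀ t ∈ Set.Icc (0:ℝ) T,
      |z t - zt t| ≤
        L * (rlInt 0 (α₂ - ε) (fun τ => |w τ - zt τ|) t
          + rlInt 0 (α₂ - 1 + ε) (fun τ => |z τ - zt τ|) t
          + T ^ (α₂ - 1) / Real.Gamma α₂ *
              (⨆ τ : Set.Icc (0:ℝ) T, |rlInt 0 ε zt τ - zt τ|)) := by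
  intro t ht
  set S := ⨆ τ : Set.Icc (0:ℝ) T, |rlInt 0 ε zt τ - zt τ|
  have ha : 0 < α₂ - 1 := sub_pos.2 hα₂
  have hb : 0 < 1 - ε := sub_pos.2 hε1
  have hS : ∀ τ ∈ Icc 0 T, |rlInt 0 ε zt τ - zt τ| ≤ S := fun τ hτ =>
    le_ciSup (bddAbove_abs_rlInt_sub hε hzt) (⟨τ, hτ⟩ : Icc (0:ℝ) T)
  have hS0 : 0 ≤ S := (abs_nonneg _).trans (hS t ht)
  have hsub : ∀ {τ}, τ ∈ Icc 0 T → Icc 0 τ ⊆ Icc 0 T := fun hτ => Icc_subset_Icc_right hτ.2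
  have hcw : ContinuousOn (fun τ => |w τ - zt τ|) (Icc 0 t) := (hw.sub hzt).abs.mono (hsub ht)
  have hcz : ContinuousOn (fun τ => |z τ - zt τ|) (Icc 0 t) := (hz.sub hzt).abs.mono (hsub ht)
  have hF : ContinuousOn (fun τ => f τ (yh τ) (w τ)) (Icc 0 T) :=
    hfc.comp_continuousOn (continuousOn_id.prodMk (hyh.prodMk hw))
  have hFt : ContinuousOn (fun τ => f τ (yt τ) (zt τ)) (Icc 0 T) :=
    hfc.comp_continuousOn (continuousOn_id.prodMk (hyt.prodMk hzt))
  have hy_le : ∀ τ ∈ Icc 0 T, |yh τ - yt τ| ≤ rlInt 0 (1 - ε) (fun σ => |w σ - zt σ|) τ := by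
    intro τ hτ
    rw [heq1 τ hτ, heq4 τ hτ, add_sub_add_left_eq_sub]
    exact abs_rlInt_sub_rlInt_le hb hτ.1 (hw.mono (hsub hτ)) (hzt.mono (hsub hτ))
  have hw_le : ∀ τ ∈ Icc 0 T, |w τ - zt τ| ≤ rlInt 0 ε (fun σ => |z σ - zt σ|) τ + S := by
    intro τ hτ
    rw [heq2 τ hτ]
    exact (abs_sub_le _ (rlInt 0 ε zt τ) _).trans (add_le_add
      (abs_rlInt_sub_rlInt_le hε hτ.1 (hz.mono (hsub hτ)) (hzt.mono (hsub hτ))) (hS τ hτ))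
  have hi₁ := intervalIntegrable_sub_rpow_mul_rlInt ha hb ht.1 hcw
  have hi₂ := intervalIntegrable_sub_rpow_mul_rlInt ha hε ht.1 hcz
  have hi₃ := intervalIntegrable_sub_rpow_mul ha ht.1
    (continuousOn_const : ContinuousOn (fun _ => S) (Icc 0 t))
  have hsplit : (fun τ => (t - τ) ^ (α₂ - 1 - 1) *
      (L * (rlInt 0 (1 - ε) (fun σ => |w σ - zt σ|) τ
        + (rlInt 0 ε (fun σ => |z σ - zt σ|) τ + S)))) =
      fun τ => L * ((t - τ) ^ (α₂ - 1 - 1) * rlInt 0 (1 - ε) (fun σ => |w σ - zt σ|) τ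
        + ((t - τ) ^ (α₂ - 1 - 1) * rlInt 0 ε (fun σ => |z σ - zt σ|) τ
          + (t - τ) ^ (α₂ - 1 - 1) * S)) := by
    ext τ
    ring
  have hbound : rlInt 0 (α₂ - 1) (fun τ => L * (rlInt 0 (1 - ε) (fun σ => |w σ - zt σ|) τ
        + (rlInt 0 ε (fun σ => |z σ - zt σ|) τ + S))) t =
      L * (rlInt 0 (α₂ - ε) (fun τ => |w τ - zt τ|) t
        + rlInt 0 (α₂ - 1 + ε) (fun τ => |z τ - zt τ|) t
        + t ^ (α₂ - 1) / Real.Gamma α₂ * S) := by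
    have h₁ := rlInt_rlInt ha hb ht.1 hcw
    have h₂ := rlInt_rlInt ha hε ht.1 hcz
    have h₃ := rlInt_const ha S t
    rw [show α₂ - 1 + (1 - ε) = α₂ - ε by ring] at h₁
    rw [sub_add_cancel] at h₃
    rw [← h₁, ← h₂, ← h₃, rlInt, hsplit, intervalIntegral.integral_const_mul,
      intervalIntegral.integral_add hi₁ (hi₂.add hi₃), intervalIntegral.integral_add hi₂ hi₃]
    simp only [rlInt.eq_1 0 (α₂ - 1)]
    ring
  have hmain : |z t - zt t| ≤ L * (rlInt 0 (α₂ - ε) (fun τ => |w τ - zt τ|) t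
        + rlInt 0 (α₂ - 1 + ε) (fun τ => |z τ - zt τ|) t
        + t ^ (α₂ - 1) / Real.Gamma α₂ * S) := by
    rw [← hbound, heq3 t ht, heq5 t ht, add_sub_add_left_eq_sub,
      rlInt_sub ha ht.1 (hF.mono (hsub ht)) (hFt.mono (hsub ht))]
    refine abs_rlInt_le ha ht.1 ?_ fun τ hτ => ?_
    · rw [hsplit]
      exact (hi₁.add (hi₂.add hi₃)).const_mul L
    · have hτT := hsub ht hτ
      exact (hlip τ hτT _ _ _ _).trans
        (mul_le_mul_of_nonneg_left (add_le_add (hy_le τ hτT) (hw_le τ hτT)) hL.le)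
  have hΓ : 0 < Real.Gamma α₂ := Real.Gamma_pos_of_pos (by linarith)
  have hpow : t ^ (α₂ - 1) ≤ T ^ (α₂ - 1) := Real.rpow_le_rpow ht.1 ht.2 ha.le
  refine hmain.trans ?_
  gcongr
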